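/- Let 𝒳 and 𝒴 be normal G-automata with ⟦𝒳⟧ = ⟦𝒴⟧, and let y be the initial state of 𝒴. Then the map π : r(𝒴) → m(𝒳) given by π(z) = w_z⁻¹⟦𝒳⟧, for any w_z ∈ GS⁻ with y →^{w_z} z in 𝒴, is well defined (independent of the choice of w_z, and w_z ∈ R(x) for the initial state x of 𝒳), is a surjective G-automata homomorphism from the reachable sub-automaton r(𝒴) to m(𝒳), and is the unique G-automata homomorphism r(𝒴) → m(𝒳). -/

import Mathlib

open scoped Classical

/-- Guarded strings `GS = (At·Σ)*·At`, represented as a pair of a word in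
`(At·Σ)*` (the guarded string without terminating atom) and a terminating atom. -/
abbrev GS (At Act : Type*) := List (At × Act) × At

variable {At Act X Y : Type*}

/-- Acceptance of a guarded string by a state of a `G`-coalgebra. -/
def GAccepts (δ : X → At → Bool ⊕ (Act × X)) : X → List (At × Act) → At → Prop
  | x, [], β => δ x β = Sum.inl true
  | x, (α, p) :: w, β => ∃ y, δ x α = Sum.inr (p, y) ∧ GAccepts δ y w β

/-- The language `⟦x⟧ ⊆ GS` of a state of a `G`-coalgebra. -/
def glang (δ : X → At → Bool ⊕ (Act × X)) (x : X) : Set (GS At Act) :=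
  {g | GAccepts δ x g.1 g.2}

/-- The transition relation `x →^w y` of a `G`-coalgebra. -/
inductive GReaches (δ : X → At → Bool ⊕ (Act × X)) : X → List (At × Act) → X → Prop
  | refl (x : X) : GReaches δ x [] x
  | single {x : X} {α : At} {p : Act} {y : X} :
      δ x α = Sum.inr (p, y) → GReaches δ x [(α, p)] y
  | snoc {x y z : X} {v : List (At × Act)} {α : At} {p : Act} :
      GReaches δ x v y → δ y α = Sum.inr (p, z) → GReaches δ x (v ++ [(α, p)]) z

/-- The set `r(x)` of states reachable from `x`. -/
def grState (δ : X → At → Bool ⊕ (Act × X)) (x : X) : Set X :=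
  {y | ∃ w, GReaches δ x w y}

/-- The set `R(x)` of words witnessing reachability from `x`. -/
def gRWords (δ : X → At → Bool ⊕ (Act × X)) (x : X) : Set (List (At × Act)) :=
  {w | ∃ y, GReaches δ x w y}

/-- A `G`-coalgebra is normal if it only transitions to live states. -/
def GNormal (δ : X → At → Bool ⊕ (Act × X)) : Prop :=
  ∀ x α p y, δ x α = Sum.inr (p, y) → (glang δ y).Nonempty

/-- The derivative `w⁻¹L` of a guarded-string language. -/
def gderiv (w : List (At × Act)) (L : Set (GS At Act)) : Set (GS At Act) :=
  {u | (w ++ u.1, u.2) ∈ L}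

/-- The transition map of the minimization `m(𝒳)` (defined on all of `Set GS`). -/
noncomputable def minDelta : Set (GS At Act) → At → Bool ⊕ (Act × Set (GS At Act)) :=
  fun L α =>
    if h : ∃ p : Act, (gderiv [(α, p)] L).Nonempty then
      Sum.inr (h.choose, gderiv [(α, h.choose)] L)
    else if (([], α) : GS At Act) ∈ L then Sum.inl true
    else Sum.inl false

/-- The state space `{w⁻¹⟦𝒳⟧ | w ∈ R(x)}` of the minimization `m(𝒳)`. -/
def MinStates (δ : X → At → Bool ⊕ (Act × X)) (x : X) : Set (Set (GS At Act)) :=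
  {L | ∃ w ∈ gRWords δ x, L = gderiv w (glang δ x)}

/-- Restriction of a `G`-coalgebra to an invariant subset of states. -/
def grestrict (δ : X → At → Bool ⊕ (Act × X)) (A : Set X)
    (hA : ∀ y ∈ A, ∀ (α : At) (p : Act) (z : X), δ y α = Sum.inr (p, z) → z ∈ A) :
    A → At → Bool ⊕ (Act × A) := fun y α =>
  match h : δ y.val α with
  | Sum.inl b => Sum.inl b
  | Sum.inr (p, z) => Sum.inr (p, ⟨z, hA y.val y.2 α p z h⟩)

/-- Compatibility of two guarded strings: they agree on their first `n` actions
(or lack thereof) whenever they agree on their first `n` atoms. -/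
def GCompat : List (At × Act) → At → List (At × Act) → At → Prop
  | [], _, [], _ => True
  | [], β, (α, _) :: _, _ => β ≠ α
  | (α, _) :: _, _, [], β => β ≠ α
  | (α, p) :: u, β, (α', p') :: u', β' => α = α' → p = p' ∧ GCompat u β u' β'

/-- A guarded-string language is deterministic if any two of its strings that agree
on their first `n` atoms also agree on their first `n` actions (or lack thereof). -/
def GDetLang (L : Set (GS At Act)) : Prop :=
  ∀ u ∈ L, ∀ v ∈ L, GCompat u.1 u.2 v.1 v.2

/-- Bisimulations between `G`-coalgebras. -/
def IsGBisim (δX : X → At → Bool ⊕ (Act × X)) (δY : Y → At → Bool ⊕ (Act × Y))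
    (R : X → Y → Prop) : Prop :=
  ∀ x y, R x y → ∀ α : At,
    (∀ b : Bool, δX x α = Sum.inl b → δY y α = Sum.inl b) ∧
    (∀ p x', δX x α = Sum.inr (p, x') → ∃ y', δY y α = Sum.inr (p, y') ∧ R x' y')

/-- Bisimilarity of states of `G`-coalgebras. -/
def GBisimilar (δX : X → At → Bool ⊕ (Act × X)) (δY : Y → At → Bool ⊕ (Act × Y))
    (x : X) (y : Y) : Prop :=
  ∃ R, IsGBisim δX δY R ∧ R x y

/-- Simulations between `G`-coalgebras. -/
def IsGSim (δX : X → At → Bool ⊕ (Act × X)) (δY : Y → At → Bool ⊕ (Act × Y))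
    (R : X → Y → Prop) : Prop :=
  ∀ x y, R x y → ∀ α : At,
    (δX x α = Sum.inl true → δY y α = Sum.inl true) ∧
    (∀ p x', δX x α = Sum.inr (p, x') → ∃ y', δY y α = Sum.inr (p, y') ∧ R x' y')

/-- Similarity of states of `G`-coalgebras. -/
def GSimilar (δX : X → At → Bool ⊕ (Act × X)) (δY : Y → At → Bool ⊕ (Act × Y))
    (x : X) (y : Y) : Prop :=
  ∃ R, IsGSim δX δY R ∧ R x y

/-- Observation tables for the `GL*` algorithm. -/
structure ObsTable (At Act : Type*) where
  S : Set (List (At × Act))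
  E : Set (GS At Act)
  row : List (At × Act) → Set (GS At Act)
  eps_mem : [] ∈ S
  atoms_mem : ∀ α : At, (([], α) : GS At Act) ∈ E
  prefix_closed : ∀ (s : List (At × Act)) (α : At) (p : Act), s ++ [(α, p)] ∈ S → s ∈ S
  suffix_closed : ∀ (α : At) (p : Act) (e : GS At Act), (((α, p) :: e.1, e.2) : GS At Act) ∈ E → e ∈ E
  row_sub : ∀ t, row t ⊆ E
  rows_distinct : ∀ s ∈ S, ∀ t ∈ S, row s = row t → s = t
  row_nonempty : ∀ s ∈ S, s ≠ [] → (row s).Nonempty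
  row_compat : ∀ s ∈ S, ∀ (α : At) (p : Act) (e : GS At Act),
      (((α, p) :: e.1, e.2) : GS At Act) ∈ E →
      (e ∈ row (s ++ [(α, p)]) ↔ (((α, p) :: e.1, e.2) : GS At Act) ∈ row s)

/-- A table is deterministic if all of its upper rows are deterministic languages. -/
def ObsTable.Det (T : ObsTable At Act) : Prop := ∀ s ∈ T.S, GDetLang (T.row s)

/-- A table is closed if every nonzero lower row equals some upper row. -/
def ObsTable.Closed (T : ObsTable At Act) : Prop :=
  ∀ s ∈ T.S, ∀ (α : At) (p : Act), (T.row (s ++ [(α, p)])).Nonempty →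
    ∃ t ∈ T.S, T.row t = T.row (s ++ [(α, p)])

/-- The transition map of the hypothesis automaton `m(T)` (defined on all of `Set GS`). -/
noncomputable def hypDelta (T : ObsTable At Act) :
    Set (GS At Act) → At → Bool ⊕ (Act × Set (GS At Act)) := fun L α =>
  if h : ∃ s, s ∈ T.S ∧ T.row s = L then
    if hp : ∃ p : Act, (T.row (h.choose ++ [(α, p)])).Nonempty then
      Sum.inr (hp.choose, T.row (h.choose ++ [(α, hp.choose)]))
    else if (([], α) : GS At Act) ∈ L then Sum.inl true
    else Sum.inl false
  else Sum.inl false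

/-- The state space `{row(s) | s ∈ S}` of the hypothesis automaton `m(T)`. -/
def HypStates (T : ObsTable At Act) : Set (Set (GS At Act)) := T.row '' T.S

/-- A `G`-automaton `(Y, δY, y)` is consistent with an observation table `T`. -/
def ConsistentWith (T : ObsTable At Act) (δY : Y → At → Bool ⊕ (Act × Y)) (y : Y) : Prop :=
  T.S ⊆ gRWords δY y ∧
  ∀ s ∈ T.S, ∀ ys, GReaches δY y s ys → ∀ e ∈ T.E, (e ∈ glang δY ys ↔ e ∈ T.row s)

/-- Guarded-string suffixes of a guarded string (auxiliary version). -/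
def gsufAux : List (At × Act) → At → Set (GS At Act)
  | [], β => {(([] : List (At × Act)), β)}
  | ap :: w, β => insert ((ap :: w, β) : GS At Act) (gsufAux w β)

/-- The set `suf(z)` of guarded-string suffixes of a guarded string `z`. -/
def gsuf (z : GS At Act) : Set (GS At Act) := gsufAux z.1 z.2

/-- Acceptance for Moore automata with input `At·Σ` and output `2^At`. -/
def MAccepts (tr : Y → (At × Act) → Y) (out : Y → At → Bool) : Y → List (At × Act) → At → Prop
  | y, [], β => out y β = true
  | y, ap :: w, β => MAccepts tr out (tr y ap) w β

/-- The language of a state of a Moore automaton with input `At·Σ` and output `2^At`. -/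
def mlang (tr : Y → (At × Act) → Y) (out : Y → At → Bool) (y : Y) : Set (GS At Act) :=
  {g | MAccepts tr out y g.1 g.2}

/-- Transition map of the Moore automaton `f(𝒳)` obtained from a `G`-automaton
by adding a sink state `⋆` (`= none`). -/
noncomputable def fTrans (δ : X → At → Bool ⊕ (Act × X)) : Option X → (At × Act) → Option X :=
  fun s ap =>
    match s with
    | none => none
    | some y =>
      match δ y ap.1 with
      | Sum.inl _ => none
      | Sum.inr (q, z) => if q = ap.2 then some z else none

/-- Output map of the Moore automaton `f(𝒳)`. -/
noncomputable def fOut (δ : X → At → Bool ⊕ (Act × X)) : Option X → At → Bool :=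
  fun s α =>
    match s with
    | none => false
    | some y => if δ y α = Sum.inl true then true else false

/-- The map `π(z) = w_z⁻¹⟦𝒳⟧` from the reachable part of `𝒴` to the minimization of
`𝒳`, where `w_z` is a chosen word with `y →^(w_z) z`. -/
noncomputable def piMap {At Act X Y : Type*} (δX : X → At → Bool ⊕ (Act × X)) (x : X)
    (δY : Y → At → Bool ⊕ (Act × Y)) (y : Y) (z : Y) : Set (GS At Act) :=
  if h : ∃ w, GReaches δY y w z then gderiv h.choose (glang δX x) else ∅

theorem gderiv_append (v w : List (At × Act)) (L : Set (GS At Act)) :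
    gderiv (v ++ w) L = gderiv w (gderiv v L) := by
  ext u
  simp [gderiv]

theorem gderiv_singleton_glang {δ : X → At → Bool ⊕ (Act × X)} {x z : X} {α : At} {p : Act}
    (h : δ x α = Sum.inr (p, z)) : gderiv [(α, p)] (glang δ x) = glang δ z := by
  ext u
  simp [gderiv, glang, GAccepts, h]

theorem GReaches.gderiv_glang {δ : X → At → Bool ⊕ (Act × X)} {x z : X} {w : List (At × Act)}
    (h : GReaches δ x w z) : gderiv w (glang δ x) = glang δ z := by
  induction h with
  | refl => rfl
  | single h => exact gderiv_singleton_glang h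
  | snoc _ h ih => rw [gderiv_append, ih, gderiv_singleton_glang h]

theorem GReaches.induction_on_states {δ : X → At → Bool ⊕ (Act × X)} {x z : X}
    {w : List (At × Act)} {P : X → Prop} (h : GReaches δ x w z) (hx : P x)
    (hstep : ∀ y ∈ grState δ x, ∀ α p y', δ y α = Sum.inr (p, y') → P y → P y') : P z := by
  induction h with
  | refl => exact hx
  | single h => exact hstep _ ⟨[], .refl _⟩ _ _ _ h hx
  | snoc hv h ih => exact hstep _ ⟨_, hv⟩ _ _ _ h ih

/-- Every prefix of an accepted guarded string labels a path. -/
theorem exists_gReaches_of_gAccepts {δ : X → At → Bool ⊕ (Act × X)} {x : X}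
    {w : List (At × Act)} {u : List (At × Act)} {β : At} (h : GAccepts δ x (w ++ u) β) :
    ∃ z, GReaches δ x w z := by
  induction w using List.reverseRecOn generalizing u with
  | nil => exact ⟨x, .refl x⟩
  | append_singleton w a ih =>
    obtain ⟨α, p⟩ := a
    rw [List.append_assoc] at h
    obtain ⟨z, hz⟩ := ih h
    have hmem : (((α, p) :: u, β) : GS At Act) ∈ glang δ z := hz.gderiv_glang ▸ h
    obtain ⟨z', hz', -⟩ := hmem
    exact ⟨z', hz.snoc hz'⟩

theorem GNormal.glang_nonempty {δ : X → At → Bool ⊕ (Act × X)} (hN : GNormal δ) {x z : X}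
    {w : List (At × Act)} (h : GReaches δ x w z) (hw : w ≠ []) : (glang δ z).Nonempty := by
  cases h with
  | refl => exact absurd rfl hw
  | single h => exact hN _ _ _ _ h
  | snoc _ h => exact hN _ _ _ _ h

/-- Words labelling paths of a normal automaton label paths of every automaton with the same
language. -/
theorem GNormal.gRWords_subset {δX : X → At → Bool ⊕ (Act × X)} {δY : Y → At → Bool ⊕ (Act × Y)}
    (hN : GNormal δY) {x : X} {y : Y} (hL : glang δX x = glang δY y) :
    gRWords δY y ⊆ gRWords δX x := by
  rintro w ⟨z, hz⟩
  by_cases hw : w = []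
  · subst hw
    exact ⟨x, .refl x⟩
  · obtain ⟨u, hu⟩ := hN.glang_nonempty hz hw
    rw [← hz.gderiv_glang, ← hL] at hu
    exact exists_gReaches_of_gAccepts hu

theorem minDelta_glang_of_inl {δ : X → At → Bool ⊕ (Act × X)} {z : X} {α : At} {b : Bool}
    (h : δ z α = Sum.inl b) : minDelta (glang δ z) α = Sum.inl b := by
  have hne : ¬ ∃ p : Act, (gderiv [(α, p)] (glang δ z)).Nonempty := by
    rintro ⟨p, u, z', hz', -⟩
    simp [h] at hz'
  rw [minDelta, dif_neg hne]
  cases b <;> simp [glang, GAccepts, h]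

theorem GNormal.minDelta_glang_of_inr {δ : X → At → Bool ⊕ (Act × X)} (hN : GNormal δ) {z z' : X}
    {α : At} {p : Act} (h : δ z α = Sum.inr (p, z')) :
    minDelta (glang δ z) α = Sum.inr (p, glang δ z') := by
  have hex : ∃ p : Act, (gderiv [(α, p)] (glang δ z)).Nonempty :=
    ⟨p, gderiv_singleton_glang h ▸ hN _ _ _ _ h⟩
  have hp : hex.choose = p := by
    obtain ⟨u, z'', hz'', -⟩ := hex.choose_spec
    rw [h] at hz''
    exact (Prod.mk.inj (Sum.inr.inj hz'')).1.symm
  rw [minDelta, dif_pos hex, hp, gderiv_singleton_glang h]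

/-- On reachable states, `π` is the language map of `𝒴`. -/
theorem piMap_eq_glang {δX : X → At → Bool ⊕ (Act × X)} {δY : Y → At → Bool ⊕ (Act × Y)}
    {x : X} {y z : Y} (hL : glang δX x = glang δY y) (hz : z ∈ grState δY y) :
    piMap δX x δY y z = glang δY z := by
  have hex : ∃ w, GReaches δY y w z := hz
  rw [piMap, dif_pos hex, hL, hex.choose_spec.gderiv_glang]

/-- `π` is well defined (independent of the chosen witnessing word, which
moreover lies in `R(x)`), maps reachable states into the states of `m(𝒳)`, preserves the
initial state, is a surjective `G`-automata homomorphism `r(𝒴) → m(𝒳)`, and is the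
unique such homomorphism. -/
theorem pi_unique_surjective_hom {At Act : Type*} [Fintype At] [Nonempty At] [Fintype Act] [Nonempty Act] {X Y : Type*}
    (δX : X → At → Bool ⊕ (Act × X)) (x : X) (δY : Y → At → Bool ⊕ (Act × Y)) (y : Y)
    (hNX : GNormal δX) (hNY : GNormal δY) (hL : glang δX x = glang δY y) :
    (∀ z ∈ grState δY y, ∀ w, GReaches δY y w z →
        w ∈ gRWords δX x ∧ gderiv w (glang δX x) = piMap δX x δY y z) ∧
    (∀ z ∈ grState δY y, piMap δX x δY y z ∈ MinStates δX x) ∧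
    piMap δX x δY y y = glang δX x ∧
    (∀ z ∈ grState δY y, ∀ α : At,
      (∀ b : Bool, δY z α = Sum.inl b → minDelta (piMap δX x δY y z) α = Sum.inl b) ∧
      (∀ (p : Act) (z' : Y), δY z α = Sum.inr (p, z') →
          minDelta (piMap δX x δY y z) α = Sum.inr (p, piMap δX x δY y z'))) ∧
    (∀ L ∈ MinStates δX x, ∃ z ∈ grState δY y, piMap δX x δY y z = L) ∧
    (∀ g : Y → Set (GS At Act),
      g y = glang δX x →
      (∀ z ∈ grState δY y, g z ∈ MinStates δX x) →
      (∀ z ∈ grState δY y, ∀ α : At,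
        (∀ b : Bool, δY z α = Sum.inl b → minDelta (g z) α = Sum.inl b) ∧
        (∀ (p : Act) (z' : Y), δY z α = Sum.inr (p, z') →
            minDelta (g z) α = Sum.inr (p, g z'))) →
      ∀ z ∈ grState δY y, g z = piMap δX x δY y z) := by
  have hpi {z : Y} (hz : z ∈ grState δY y) := piMap_eq_glang hL hz
  have hstep {z z' : Y} {α : At} {p : Act} (hz : z ∈ grState δY y)
      (h : δY z α = Sum.inr (p, z')) : z' ∈ grState δY y :=
    hz.imp' _ fun _ hw => hw.snoc h
  refine ⟨fun z hz w hw => ⟨hNY.gRWords_subset hL ⟨z, hw⟩, ?_⟩, ?_, ?_, ?_, ?_, ?_⟩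
  · rw [hpi hz, hL, hw.gderiv_glang]
  · rintro z ⟨w, hw⟩
    exact ⟨w, hNY.gRWords_subset hL ⟨z, hw⟩, by rw [hpi ⟨w, hw⟩, hL, hw.gderiv_glang]⟩
  · rw [hpi ⟨[], .refl y⟩, hL]
  · refine fun z hz α => ⟨fun b h => ?_, fun p z' h => ?_⟩
    · rw [hpi hz, minDelta_glang_of_inl h]
    · rw [hpi hz, hpi (hstep hz h), hNY.minDelta_glang_of_inr h]
  · rintro L ⟨w, hw, rfl⟩
    obtain ⟨z, hz⟩ := hNX.gRWords_subset hL.symm hw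
    exact ⟨z, ⟨w, hz⟩, by rw [hpi ⟨w, hz⟩, hL, hz.gderiv_glang]⟩
  · intro g hgy _ hg z hz
    rw [hpi hz]
    have hgstep {z z' : Y} {α : At} {p : Act} (hz : z ∈ grState δY y)
        (h : δY z α = Sum.inr (p, z')) (hgz : g z = glang δY z) : g z' = glang δY z' := by
      have hm := (hg z hz α).2 p z' h
      rw [hgz, hNY.minDelta_glang_of_inr h] at hm
      exact (Prod.mk.inj (Sum.inr.inj hm)).2.symm
    obtain ⟨w, hw⟩ := hz
    exact hw.induction_on_states (hgy.trans hL) fun _ hz _ _ _ => hgstep hz
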